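/- There exists a symmetric positive definite matrix P ∈ ℝ^{n×n} satisfying AP + PA^T - 2BB^T < 0 (negative definite) if and only if the pair (A,B) is stabilizable. -/

import Mathlib

open Matrix

open Filter Topology

/-- Positive definiteness is an open condition among Hermitian real matrices. -/
lemma Matrix.PosDef.eventually_posDef {m : Type*} [Fintype m]
    {Q : Matrix m m ℝ} (hQ : Q.PosDef) :
    ∀ᶠ S in 𝓝 Q, S.IsHermitian → S.PosDef := by
  have hK : IsCompact (Metric.sphere (0 : m → ℝ) 1) := isCompact_sphere 0 1
  have hcont : Continuous fun z : Matrix m m ℝ × (m → ℝ) => z.2 ⬝ᵥ (z.1 *ᵥ z.2) := by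
    fun_prop
  have hev : ∀ᶠ S in 𝓝 Q, ∀ x ∈ Metric.sphere (0 : m → ℝ) 1, 0 < x ⬝ᵥ (S *ᵥ x) := by
    refine hK.eventually_forall_of_forall_eventually fun x hx => ?_
    refine hcont.continuousAt.eventually_const_lt ?_
    have hx0 : x ≠ 0 := by
      rintro rfl
      simp at hx
    simpa using hQ.dotProduct_mulVec_pos hx0
  filter_upwards [hev] with S hS hSH
  refine .of_dotProduct_mulVec_pos hSH fun x hx => ?_
  have hn : 0 < ‖x‖ := norm_pos_iff.mpr hx
  have h := hS (‖x‖⁻¹ • x) (by simp [norm_smul, hn.ne'])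
  simp only [mulVec_smul, dotProduct_smul, smul_dotProduct, smul_eq_mul] at h
  have hi : 0 < ‖x‖⁻¹ := inv_pos.mpr hn
  simpa using pos_of_mul_pos_right (pos_of_mul_pos_right h hi.le) hi.le

/-- In a complex Banach algebra, the powers of an element whose spectrum lies in the open unit
disc tend to zero. -/
lemma tendsto_pow_nhds_zero_of_forall_spectrum_norm_lt_one {𝔸 : Type*} [NormedRing 𝔸]
    [NormedAlgebra ℂ 𝔸] [CompleteSpace 𝔸] (a : 𝔸) (h : ∀ z ∈ spectrum ℂ a, ‖z‖ < 1) :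
    Tendsto (fun k : ℕ => a ^ k) atTop (𝓝 0) := by
  rcases subsingleton_or_nontrivial 𝔸 with _ | _
  · exact tendsto_const_nhds.congr fun k => Subsingleton.elim _ _
  have hr : spectralRadius ℂ a < (1 : NNReal) :=
    spectrum.spectralRadius_lt_of_forall_lt a fun z hz => by exact_mod_cast h z hz
  obtain ⟨r, hr₁, hr₂⟩ := ENNReal.lt_iff_exists_nnreal_btwn.mp hr
  have hr₂ : r < 1 := by exact_mod_cast hr₂
  have hev := (spectrum.pow_nnnorm_pow_one_div_tendsto_nhds_spectralRadius a).eventually_lt_const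
    hr₁
  have hpow : Tendsto (fun k : ℕ => (r : ℝ) ^ k) atTop (𝓝 0) :=
    tendsto_pow_atTop_nhds_zero_of_lt_one r.2 (by exact_mod_cast hr₂)
  refine squeeze_zero_norm' ?_ hpow
  filter_upwards [hev, eventually_gt_atTop 0] with k hk hk0
  have hk0' : (0 : ℝ) < k := by exact_mod_cast hk0
  rw [one_div, ENNReal.rpow_inv_lt_iff hk0', ENNReal.rpow_natCast] at hk
  exact_mod_cast hk.le

open scoped Matrix.Norms.L2Operator in
/-- The powers of a real matrix with complex spectrum in the open unit disc tend to zero. -/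
lemma Matrix.tendsto_pow_nhds_zero_of_spectrum {m : Type*} [Fintype m] [DecidableEq m]
    (F : Matrix m m ℝ) (h : ∀ z ∈ spectrum ℂ (F.map Complex.ofReal), ‖z‖ < 1) :
    Tendsto (fun k : ℕ => F ^ k) atTop (𝓝 0) := by
  have hc := tendsto_pow_nhds_zero_of_forall_spectrum_norm_lt_one _ h
  have hre : Continuous fun G : Matrix m m ℂ => G.map Complex.re :=
    continuous_id.matrix_map Complex.continuous_re
  have := (hre.tendsto 0).comp hc
  rw [show (0 : Matrix m m ℂ).map Complex.re = 0 by ext i j; simp] at this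
  refine this.congr fun k => ?_
  have hk : F.map Complex.ofReal ^ k = (F ^ k).map Complex.ofReal :=
    (map_pow Complex.ofRealHom.mapMatrix F k).symm
  ext i j
  simp [hk]

/-- The Cayley transform of a Hurwitz stable matrix has its spectrum in the open unit disc. -/
lemma norm_lt_one_of_mem_spectrum_cayley {𝔸 : Type*} [Ring 𝔸] [Algebra ℂ 𝔸] {M F : 𝔸}
    (hM : ∀ μ ∈ spectrum ℂ M, μ.re < 0) (hF : F * (1 - M) = 1 + M) {z : ℂ}
    (hz : z ∈ spectrum ℂ F) : ‖z‖ < 1 := by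
  have hu : IsUnit (1 - M) := by
    have h1 : (1 : ℂ) ∉ spectrum ℂ M := fun h => by simpa using (hM 1 h).not_ge
    simpa [spectrum.notMem_iff] using h1
  have hfac : (algebraMap ℂ 𝔸 z - F) * (1 - M) =
      algebraMap ℂ 𝔸 (z - 1) - algebraMap ℂ 𝔸 (z + 1) * M := by
    rw [sub_mul, hF]
    simp only [map_sub, map_add, map_one]
    noncomm_ring
  have hsing : ¬ IsUnit (algebraMap ℂ 𝔸 (z - 1) - algebraMap ℂ 𝔸 (z + 1) * M) := by
    rw [← hfac]
    intro h
    have hm := h.mul hu.unit⁻¹.isUnit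
    rw [mul_assoc, IsUnit.mul_val_inv, mul_one] at hm
    exact hz hm
  have hz1 : z + 1 ≠ 0 := by
    intro h0
    apply hsing
    have h2 : z - 1 ≠ 0 := fun h => by
      have : (2 : ℂ) = 0 := by linear_combination h0 - h
      norm_num at this
    simpa [h0] using (IsUnit.mk0 _ h2).map (algebraMap ℂ 𝔸)
  have hmem : (z - 1) / (z + 1) ∈ spectrum ℂ M := by
    intro h
    apply hsing
    have := ((IsUnit.mk0 _ hz1).map (algebraMap ℂ 𝔸)).mul h
    rwa [mul_sub, ← map_mul, mul_div_cancel₀ _ hz1] at this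
  have hre := hM _ hmem
  have hpos : 0 < Complex.normSq (z + 1) := Complex.normSq_pos.mpr hz1
  rw [Complex.div_re, ← add_div, div_lt_iff₀ hpos] at hre
  have hsq : ‖z‖ ^ 2 < 1 := by
    rw [Complex.sq_norm, Complex.normSq_apply]
    simp at hre
    nlinarith
  exact (sq_lt_one_iff₀ (norm_nonneg z)).mp hsq

/-- A Schur stable real matrix admits a solution of the Stein inequality. -/
lemma Matrix.exists_posDef_stein {m : Type*} [Fintype m] [DecidableEq m] {F : Matrix m m ℝ}
    (hF : Tendsto (fun k : ℕ => F ^ k) atTop (𝓝 0)) :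
    ∃ P : Matrix m m ℝ, P.PosDef ∧ (P - F * P * Fᵀ).PosDef := by
  have hlim : Tendsto (fun k : ℕ => 1 - F ^ k * (F ^ k)ᵀ) atTop (𝓝 1) := by
    have hcont : Continuous fun G : Matrix m m ℝ => 1 - G * Gᵀ := by fun_prop
    simpa [Function.comp_def] using (hcont.tendsto 0).comp hF
  have hev := hlim.eventually (PosDef.one (n := m) (R := ℝ)).eventually_posDef
  obtain ⟨N, hN, hN1⟩ := (hev.and (eventually_ge_atTop 1)).exists
  have hpd : (1 - F ^ N * (F ^ N)ᵀ).PosDef := hN (by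
    simp [IsHermitian, conjTranspose_eq_transpose_of_trivial])
  refine ⟨∑ k ∈ Finset.range N, F ^ k * (F ^ k)ᵀ, ?_, ?_⟩
  · obtain ⟨j, rfl⟩ := Nat.exists_eq_add_of_le' hN1
    rw [Finset.sum_range_succ']
    refine PosDef.posSemidef_add (posSemidef_sum _ fun k _ => ?_) (by simpa using PosDef.one)
    simpa [conjTranspose_eq_transpose_of_trivial] using
      posSemidef_self_mul_conjTranspose (F ^ (k + 1))
  · convert hpd using 1
    rw [Finset.mul_sum, Finset.sum_mul, ← Finset.sum_sub_distrib]
    have := Finset.sum_range_sub' (fun k => F ^ k * (F ^ k)ᵀ) N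
    simp only [pow_zero, transpose_one, mul_one] at this
    rw [← this]
    refine Finset.sum_congr rfl fun k _ => ?_
    rw [pow_succ' F k, transpose_mul]
    simp only [Matrix.mul_assoc]

/-- A Hurwitz stable real matrix admits a solution of the Lyapunov inequality. -/
lemma Matrix.exists_posDef_lyapunov {m : Type*} [Fintype m] [DecidableEq m] {M : Matrix m m ℝ}
    (hM : ∀ μ ∈ spectrum ℂ (M.map Complex.ofReal), μ.re < 0) :
    ∃ P : Matrix m m ℝ, P.PosDef ∧ (-(M * P + P * Mᵀ)).PosDef := by
  have hmap : (1 - M).map Complex.ofReal = 1 - M.map Complex.ofReal :=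
    (map_sub Complex.ofRealHom.mapMatrix 1 M).trans (by rw [map_one]; rfl)
  have hu : IsUnit (1 - M) := by
    have h1 : (1 : ℂ) ∉ spectrum ℂ (M.map Complex.ofReal) :=
      fun h => by simpa using (hM 1 h).not_ge
    rw [spectrum.notMem_iff, map_one, ← hmap, isUnit_iff_isUnit_det] at h1
    have hdet : ((1 - M).map Complex.ofReal).det = ((1 - M).det : ℂ) :=
      (RingHom.map_det Complex.ofRealHom (1 - M)).symm
    rw [hdet] at h1
    rw [isUnit_iff_isUnit_det, isUnit_iff_ne_zero]
    simpa using h1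
  have hu' := (isUnit_iff_isUnit_det _).mp hu
  set F := (1 + M) * (1 - M)⁻¹ with hFdef
  have hF : F * (1 - M) = 1 + M := by
    rw [hFdef, Matrix.mul_assoc, nonsing_inv_mul _ hu', Matrix.mul_one]
  have hF' : (1 - M) * F = 1 + M := by
    have hcomm : (1 - M) * (1 + M) = (1 + M) * (1 - M) := by noncomm_ring
    rw [hFdef, ← Matrix.mul_assoc, hcomm, Matrix.mul_assoc, mul_nonsing_inv _ hu', Matrix.mul_one]
  have hFc : F.map Complex.ofReal * (1 - M.map Complex.ofReal) = 1 + M.map Complex.ofReal := by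
    have h := congrArg Complex.ofRealHom.mapMatrix hF
    rw [map_mul, map_sub, map_add, map_one] at h
    exact h
  obtain ⟨P, hP, hW⟩ := exists_posDef_stein (tendsto_pow_nhds_zero_of_spectrum F
    fun z hz => norm_lt_one_of_mem_spectrum_cayley hM hFc hz)
  refine ⟨P, hP, ?_⟩
  have hconj := (IsUnit.posDef_star_right_conjugate_iff hu).mpr hW
  have heq : -(M * P + P * Mᵀ) = (2⁻¹ : ℝ) • ((1 - M) * (P - F * P * Fᵀ) * star (1 - M)) := by
    have hexp : (1 - M) * (P - F * P * Fᵀ) * star (1 - M) =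
        (1 - M) * P * (1 - M)ᵀ - ((1 - M) * F) * P * ((1 - M) * F)ᵀ := by
      rw [star_eq_conjTranspose, conjTranspose_eq_transpose_of_trivial, transpose_mul _ F]
      simp only [Matrix.mul_sub (1 - M), Matrix.sub_mul _ _ (1 - M)ᵀ, Matrix.mul_assoc]
    rw [hexp, hF', transpose_sub, transpose_add, transpose_one]
    have : (1 - M) * P * (1 - Mᵀ) - (1 + M) * P * (1 + Mᵀ) = (2 : ℝ) • (-(M * P + P * Mᵀ)) := by
      rw [two_smul]
      noncomm_ring
    rw [this, smul_smul]
    norm_num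
  rw [heq]
  exact hconj.smul (by norm_num)

/-- A solution of the Lyapunov inequality certifies Hurwitz stability. -/
lemma Matrix.re_neg_of_posDef_lyapunov {m : Type*} [Fintype m] [DecidableEq m]
    {M P : Matrix m m ℝ} (hP : P.PosDef) (hW : (-(M * P + P * Mᵀ)).PosDef) {μ : ℂ}
    (hμ : μ ∈ spectrum ℂ (M.map Complex.ofReal)) : μ.re < 0 := by
  rw [spectrum.mem_iff, isUnit_iff_isUnit_det, isUnit_iff_ne_zero, not_not,
    ← exists_vecMul_eq_zero_iff] at hμ
  obtain ⟨v, hv, hvM⟩ := hμ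
  have hvM : v ᵥ* M.map Complex.ofReal = μ • v := by
    rw [vecMul_sub, sub_eq_zero, Algebra.algebraMap_eq_smul_one, vecMul_smul, vecMul_one] at hvM
    exact hvM.symm
  set a : m → ℝ := fun i => (v i).re with ha
  set b : m → ℝ := fun i => (v i).im with hb
  have haM : a ᵥ* M = μ.re • a - μ.im • b := by
    ext i
    simpa [vecMul, dotProduct, a, b] using congrArg Complex.re (congrFun hvM i)
  have hbM : b ᵥ* M = μ.im • a + μ.re • b := by
    ext i
    simpa [vecMul, dotProduct, a, b, add_comm] using congrArg Complex.im (congrFun hvM i)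
  have hPT : Pᵀ = P := by
    simpa [IsHermitian, conjTranspose_eq_transpose_of_trivial] using hP.isHermitian
  have hsymm (x y : m → ℝ) : x ⬝ᵥ (P *ᵥ y) = y ⬝ᵥ (P *ᵥ x) := by
    rw [dotProduct_mulVec, dotProduct_comm, ← mulVec_transpose, hPT]
  have hquad (x : m → ℝ) :
      x ⬝ᵥ (-(M * P + P * Mᵀ) *ᵥ x) = -2 * ((x ᵥ* M) ⬝ᵥ (P *ᵥ x)) := by
    have h1 : x ⬝ᵥ ((M * P) *ᵥ x) = (x ᵥ* M) ⬝ᵥ (P *ᵥ x) := by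
      rw [← mulVec_mulVec, dotProduct_mulVec]
    have h2 : x ⬝ᵥ ((P * Mᵀ) *ᵥ x) = (x ᵥ* M) ⬝ᵥ (P *ᵥ x) := by
      rw [← mulVec_mulVec, mulVec_transpose, hsymm]
    rw [neg_mulVec, add_mulVec, dotProduct_neg, dotProduct_add, h1, h2]
    ring
  have hsum : a ⬝ᵥ (-(M * P + P * Mᵀ) *ᵥ a) + b ⬝ᵥ (-(M * P + P * Mᵀ) *ᵥ b) =
      -2 * μ.re * (a ⬝ᵥ (P *ᵥ a) + b ⬝ᵥ (P *ᵥ b)) := by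
    rw [hquad, hquad, haM, hbM]
    simp only [sub_dotProduct, add_dotProduct, smul_dotProduct, smul_eq_mul, hsymm b a]
    ring
  have hab : a ≠ 0 ∨ b ≠ 0 := by
    by_contra! h
    exact hv (funext fun i => Complex.ext (congrFun h.1 i) (congrFun h.2 i))
  have hpos {S : Matrix m m ℝ} (hS : S.PosDef) : 0 < a ⬝ᵥ (S *ᵥ a) + b ⬝ᵥ (S *ᵥ b) := by
    have hnn (x : m → ℝ) : 0 ≤ x ⬝ᵥ (S *ᵥ x) := by
      simpa using hS.posSemidef.dotProduct_mulVec_nonneg x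
    rcases hab with h | h
    · exact add_pos_of_pos_of_nonneg (by simpa using hS.dotProduct_mulVec_pos h) (hnn b)
    · exact add_pos_of_nonneg_of_pos (hnn a) (by simpa using hS.dotProduct_mulVec_pos h)
  have h1 := hpos hW
  have h2 := hpos hP
  rw [hsum] at h1
  nlinarith

/-- There exists a symmetric positive definite `P` with
`A P + P Aᵀ - 2 B Bᵀ < 0` iff the pair `(A, B)` is stabilizable,
i.e. there exists `K` such that all (complex) eigenvalues of `A + B K`
have negative real parts. -/
theorem lmi_feasible_iff_stabilizable
    {n p : ℕ} (A : Matrix (Fin n) (Fin n) ℝ) (B : Matrix (Fin n) (Fin p) ℝ) :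
    (∃ P : Matrix (Fin n) (Fin n) ℝ, P.PosDef ∧
      (-(A * P + P * Aᵀ - (2 : ℝ) • (B * Bᵀ))).PosDef) ↔
    (∃ K : Matrix (Fin p) (Fin n) ℝ,
      ∀ μ : ℂ, μ ∈ spectrum ℂ ((A + B * K).map (Complex.ofReal)) → μ.re < 0) := by
  constructor
  · rintro ⟨P, hP, hW⟩
    have hPT : Pᵀ = P := by
      simpa [IsHermitian, conjTranspose_eq_transpose_of_trivial] using hP.isHermitian
    have hu : IsUnit P.det := (isUnit_iff_isUnit_det _).mp hP.isUnit
    have hKP : (A + B * -(Bᵀ * P⁻¹)) * P = A * P - B * Bᵀ := by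
      rw [Matrix.add_mul, Matrix.mul_neg, Matrix.neg_mul, ← Matrix.mul_assoc,
        Matrix.mul_assoc (B * Bᵀ), nonsing_inv_mul _ hu, Matrix.mul_one, sub_eq_add_neg]
    have hPK : P * (A + B * -(Bᵀ * P⁻¹))ᵀ = P * Aᵀ - B * Bᵀ := by
      have := congrArg transpose hKP
      rwa [transpose_mul, transpose_sub, transpose_mul, transpose_mul, transpose_transpose,
        hPT] at this
    refine ⟨-(Bᵀ * P⁻¹), fun μ hμ => re_neg_of_posDef_lyapunov hP ?_ hμ⟩
    convert hW using 2
    rw [hKP, hPK, two_smul]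
    abel
  · rintro ⟨K, hK⟩
    obtain ⟨P, hP, hQ⟩ := exists_posDef_lyapunov hK
    have hPT : Pᵀ = P := by
      simpa [IsHermitian, conjTranspose_eq_transpose_of_trivial] using hP.isHermitian
    set Q := -((A + B * K) * P + P * (A + B * K)ᵀ) with hQdef
    set C := K * P with hC
    have hlim : Tendsto (fun s : ℝ => Q - s • (Cᵀ * C)) (𝓝[>] 0) (𝓝 Q) := by
      have hcont : Continuous fun s : ℝ => Q - s • (Cᵀ * C) := by fun_prop
      simpa using (hcont.tendsto 0).mono_left nhdsWithin_le_nhds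
    obtain ⟨s, hs, hs0⟩ :=
      ((hlim.eventually hQ.eventually_posDef).and self_mem_nhdsWithin).exists
    have hs0 : 0 < s := hs0
    have hpd := hs (hQ.isHermitian.sub (by
      simp [IsHermitian, conjTranspose_eq_transpose_of_trivial]))
    have hsq : (s⁻¹ • ((B + s • Cᵀ) * (B + s • Cᵀ)ᵀ)).PosSemidef := by
      have := posSemidef_self_mul_conjTranspose (B + s • Cᵀ)
      rw [conjTranspose_eq_transpose_of_trivial] at this
      exact this.smul (by positivity)
    refine ⟨(2 * s) • P, hP.smul (by positivity), ?_⟩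
    convert (hpd.add_posSemidef hsq).smul (show (0 : ℝ) < 2 * s by positivity) using 1
    have hCT : Cᵀ = P * Kᵀ := by rw [hC, transpose_mul, hPT]
    have e1 : (A + B * K) * P = A * P + B * C := by rw [Matrix.add_mul, Matrix.mul_assoc]
    have e2 : P * (A + B * K)ᵀ = P * Aᵀ + Cᵀ * Bᵀ := by
      rw [transpose_add, Matrix.mul_add, transpose_mul, hCT, Matrix.mul_assoc]
    have e3 : (B + s • Cᵀ) * (B + s • Cᵀ)ᵀ =
        B * Bᵀ + s • (B * C) + s • (Cᵀ * Bᵀ) + (s * s) • (Cᵀ * C) := by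
      simp only [transpose_add, transpose_smul, transpose_transpose, Matrix.mul_add,
        Matrix.add_mul, Matrix.mul_smul, Matrix.smul_mul, smul_add, mul_smul]
      abel
    rw [hQdef, e1, e2, e3, Matrix.mul_smul, Matrix.smul_mul]
    ext i j
    simp only [Matrix.neg_apply, Matrix.add_apply, Matrix.sub_apply, Matrix.smul_apply,
      smul_eq_mul]
    field_simp
    ring
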